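/- For each δ > 0 there is a constant C(δ) such that the following holds. Consider a Markov chain on states {1,2,3} with transition matrix rows (p_1, q_1, η_1), (q_2, p_2, η_2), (0, 0, 1) and initial distribution (π_1, π_2, π_3), and assume q_1 > δ and η_2 > δ. Let 𝔩_1 and 𝔩_2 denote the total occupation times of states 1 and 2. Then |Cov(𝔩_1, 𝔩_2)| ≤ C(δ) ( | (q_1/(q_1+η_1)) (1 − π_1) − π_2 | + q_2 ). -/

import Mathlib

open MeasureTheory Filter Topology

noncomputable section

/-- Total occupation time of state `i` by the chain `Y`. -/
def occTime {Ω : Type*} (Y : ℕ → Ω → Fin 3) (i : Fin 3) (ω : Ω) : ℕ :=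
  Set.ncard {n : ℕ | Y n ω = i}

/-- Telescoping: a nonnegative sequence that is the decrement of a nonnegative one is summable. -/
lemma summable_of_telescoping {x h : ℕ → ℝ} (hx : ∀ n, 0 ≤ x n) (hh : ∀ n, 0 ≤ h n)
    (hstep : ∀ n, h n = x n + h (n + 1)) : Summable x := by
  refine summable_of_sum_range_le (c := h 0) hx fun n => ?_
  have key : ∑ i ∈ Finset.range n, x i = h 0 - h n := by
    rw [← Finset.sum_range_sub' h n]
    exact Finset.sum_congr rfl fun i _ => by rw [hstep i]; ring
  linarith [hh n]

lemma hasSum_of_telescoping {x h : ℕ → ℝ} (hx : ∀ n, 0 ≤ x n)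
    (hstep : ∀ n, h n = x n + h (n + 1)) (hlim : Tendsto h atTop (𝓝 0)) : HasSum x (h 0) := by
  rw [hasSum_iff_tendsto_nat_of_nonneg hx]
  have key : ∀ n, ∑ i ∈ Finset.range n, x i = h 0 - h n := fun n => by
    rw [← Finset.sum_range_sub' h n]
    exact Finset.sum_congr rfl fun i _ => by rw [hstep i]; ring
  simp_rw [key]
  simpa using hlim.const_sub (h 0)

/-- The sums over time of the mass that a killed two-state chain carries. -/
lemma hasSum_two_state {x y : ℕ → ℝ} {p₁ q₁ η₁ q₂ p₂ η₂ D : ℝ}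
    (hx : ∀ n, 0 ≤ x n) (hy : ∀ n, 0 ≤ y n)
    (hq₁ : 0 ≤ q₁) (hη₁ : 0 ≤ η₁) (hq₂ : 0 ≤ q₂) (hη₂ : 0 ≤ η₂)
    (h₁ : p₁ + q₁ + η₁ = 1) (h₂ : q₂ + p₂ + η₂ = 1)
    (hDdef : D = (q₁ + η₁) * (q₂ + η₂) - q₁ * q₂) (hD : 0 < D)
    (hxs : ∀ n, x (n + 1) = p₁ * x n + q₂ * y n)
    (hys : ∀ n, y (n + 1) = q₁ * x n + p₂ * y n) :
    HasSum x ((x 0 * (q₂ + η₂) + y 0 * q₂) / D) ∧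
      HasSum y ((x 0 * q₁ + y 0 * (q₁ + η₁)) / D) := by
  obtain rfl : p₁ = 1 - q₁ - η₁ := by linarith
  obtain rfl : p₂ = 1 - q₂ - η₂ := by linarith
  set f : ℕ → ℝ := fun n => (x n * (q₂ + η₂) + y n * q₂) / D with hf
  set g : ℕ → ℝ := fun n => (x n * q₁ + y n * (q₁ + η₁)) / D with hg
  have hfs : ∀ n, f n = x n + f (n + 1) := fun n => by
    simp only [hf, hxs, hys]; field_simp; rw [hDdef]; ring
  have hgs : ∀ n, g n = y n + g (n + 1) := fun n => by
    simp only [hg, hxs, hys]; field_simp; rw [hDdef]; ring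
  have hf0 : ∀ n, 0 ≤ f n := fun n => by have := hx n; have := hy n; simp only [hf]; positivity
  have hg0 : ∀ n, 0 ≤ g n := fun n => by have := hx n; have := hy n; simp only [hg]; positivity
  have tx := (summable_of_telescoping hx hf0 hfs).tendsto_atTop_zero
  have ty := (summable_of_telescoping hy hg0 hgs).tendsto_atTop_zero
  refine ⟨hasSum_of_telescoping hx hfs ?_, hasSum_of_telescoping hy hgs ?_⟩
  · simpa using ((tx.mul_const (q₂ + η₂)).add (ty.mul_const q₂)).div_const D
  · simpa using ((tx.mul_const q₁).add (ty.mul_const (q₁ + η₁))).div_const D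

/-- A double series over `ℕ × ℕ` vanishing on the diagonal, split along the diagonal. -/
lemma ENNReal.tsum_tsum_eq_of_diag_eq_zero (f : ℕ → ℕ → ENNReal) (hf : ∀ n, f n n = 0) :
    ∑' m, ∑' n, f m n = (∑' m, ∑' k, f m (m + k)) + ∑' n, ∑' k, f (n + k) n := by
  have shift : ∀ (g : ℕ → ENNReal) (m : ℕ),
      ∑' n, (if m ≤ n then g n else 0) = ∑' k, g (m + k) := fun g m => by
    have h := ENNReal.summable.sum_add_tsum_nat_add' (k := m)
      (f := fun n => if m ≤ n then g n else 0)
    rw [Finset.sum_eq_zero, zero_add] at h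
    · simpa [add_comm] using h.symm
    · intro i hi
      simp [Finset.mem_range.1 hi]
  have split : ∀ m n, f m n = (if m ≤ n then f m n else 0) + if n ≤ m then f m n else 0 :=
    fun m n => by
      rcases lt_trichotomy m n with h | rfl | h
      · simp [h.le, h.not_ge]
      · simp [hf]
      · simp [h.le, h.not_ge]
  calc ∑' m, ∑' n, f m n
      = ∑' m, ∑' n, ((if m ≤ n then f m n else 0) + if n ≤ m then f m n else 0) :=
        tsum_congr fun m => tsum_congr fun n => split m n
    _ = (∑' m, ∑' n, if m ≤ n then f m n else 0) + ∑' m, ∑' n, if n ≤ m then f m n else 0 := by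
        simp_rw [ENNReal.tsum_add]
    _ = _ := by
        rw [ENNReal.tsum_comm (f := fun m n => if n ≤ m then f m n else 0)]
        congr 1
        · exact tsum_congr fun m => shift (f m) m
        · exact tsum_congr fun n => shift (fun m => f m n) n

lemma occTime_eq_toReal_tsum {Ω : Type*} (Y : ℕ → Ω → Fin 3) (i : Fin 3) (ω : Ω) :
    (occTime Y i ω : ℝ) = (∑' n, {ω | Y n ω = i}.indicator (1 : Ω → ENNReal) ω).toReal := by
  have h : ∑' n, {ω | Y n ω = i}.indicator (1 : Ω → ENNReal) ω
      = ({n : ℕ | Y n ω = i}.encard : ENNReal) := by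
    rw [← ENNReal.tsum_set_one, tsum_subtype {n : ℕ | Y n ω = i} (fun _ => (1 : ENNReal))]
    rfl
  rw [h, occTime, Set.ncard]
  cases {n : ℕ | Y n ω = i}.encard <;> simp

section Chain

variable {Ω : Type*} [MeasurableSpace Ω] {μ : Measure Ω} [IsProbabilityMeasure μ]
  {Y : ℕ → Ω → Fin 3} {P : Fin 3 → Fin 3 → ℝ}

lemma measureReal_eq_sum_inter_fiber {Z : Ω → Fin 3} (hZ : Measurable Z) (A : Set Ω) :
    μ.real A = ∑ i, μ.real (A ∩ {ω | Z ω = i}) := by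
  have h := sum_measureReal_preimage_singleton (μ := μ.restrict A) (f := Z) Finset.univ
    (fun i _ => hZ (measurableSet_singleton i))
  simp only [Finset.coe_univ, Set.preimage_univ] at h
  rw [measureReal_restrict_apply MeasurableSet.univ, Set.univ_inter] at h
  rw [← h]
  refine Finset.sum_congr rfl fun i _ => ?_
  rw [measureReal_restrict_apply (hZ (measurableSet_singleton i)), Set.inter_comm]
  rfl

/-- The path-wise Markov property gives the Markov property for events of the past. -/
lemma markov_past (hY : ∀ n, Measurable (Y n))
    (hM : ∀ (n : ℕ) (w : ℕ → Fin 3) (j : Fin 3),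
      μ.real {ω | (∀ k ≤ n, Y k ω = w k) ∧ Y (n + 1) ω = j}
        = P (w n) j * μ.real {ω | ∀ k ≤ n, Y k ω = w k})
    (n : ℕ) (S : Set (Fin (n + 1) → Fin 3)) (i j : Fin 3) (hS : ∀ w ∈ S, w (Fin.last n) = i) :
    μ.real {ω | (fun k : Fin (n + 1) => Y k ω) ∈ S ∧ Y (n + 1) ω = j}
      = P i j * μ.real {ω | (fun k : Fin (n + 1) => Y k ω) ∈ S} := by
  classical
  set X : Ω → Fin (n + 1) → Fin 3 := fun ω k => Y k ω with hX
  have hXm : Measurable X := measurable_pi_lambda _ fun k => hY k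
  have hB : MeasurableSet {ω | Y (n + 1) ω = j} := hY (n + 1) (measurableSet_singleton j)
  have e₁ := sum_measureReal_preimage_singleton (μ := μ) (f := X) S.toFinset
    (fun w _ => hXm (measurableSet_singleton w))
  have e₂ := sum_measureReal_preimage_singleton (μ := μ.restrict {ω | Y (n + 1) ω = j}) (f := X)
    S.toFinset (fun w _ => hXm (measurableSet_singleton w))
  rw [Set.coe_toFinset] at e₁ e₂
  rw [measureReal_restrict_apply (hXm S.toFinite.measurableSet)] at e₂
  change μ.real (X ⁻¹' S ∩ {ω | Y (n + 1) ω = j}) = P i j * μ.real (X ⁻¹' S)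
  rw [← e₁, ← e₂, Finset.mul_sum]
  refine Finset.sum_congr rfl fun w hw => ?_
  rw [measureReal_restrict_apply (hXm (measurableSet_singleton w))]
  let v : ℕ → Fin 3 := fun k => if h : k < n + 1 then w ⟨k, h⟩ else 0
  have hv : ∀ ω, (∀ k ≤ n, Y k ω = v k) ↔ X ω = w := fun ω => by
    constructor
    · intro h
      funext k
      have := h k (Nat.lt_succ_iff.1 k.2)
      simpa only [v, dif_pos k.2] using this
    · rintro rfl k hk
      simp only [v, hX, dif_pos (Nat.lt_succ_iff.2 hk)]
  have hvn : v n = i := by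
    rw [← hS w (Set.mem_toFinset.1 hw)]
    simp [v, Fin.last]
  have := hM n v j
  simp only [hv, hvn] at this
  exact this

lemma measureReal_pair_succ (hY : ∀ n, Measurable (Y n))
    (hM : ∀ (n : ℕ) (w : ℕ → Fin 3) (j : Fin 3),
      μ.real {ω | (∀ k ≤ n, Y k ω = w k) ∧ Y (n + 1) ω = j}
        = P (w n) j * μ.real {ω | ∀ k ≤ n, Y k ω = w k})
    (E : Set (Fin 3)) (m k : ℕ) (j : Fin 3) :
    μ.real {ω | Y m ω ∈ E ∧ Y (m + (k + 1)) ω = j}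
      = ∑ i, P i j * μ.real {ω | Y m ω ∈ E ∧ Y (m + k) ω = i} := by
  rw [measureReal_eq_sum_inter_fiber (hY (m + k))]
  refine Finset.sum_congr rfl fun i _ => ?_
  have h := markov_past hY hM (m + k)
    {w | w ⟨m, by omega⟩ ∈ E ∧ w (Fin.last (m + k)) = i} i j (fun w hw => hw.2)
  simp only [Set.mem_ofPred_eq, Fin.val_last] at h
  rw [← h]
  congr 1
  ext ω
  simp only [Set.mem_inter_iff, Set.mem_ofPred_eq, add_assoc]
  tauto

/-- The sums over later times of the probability of `{Y m ∈ E}` jointly with a transient state. -/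
lemma hasSum_measureReal_pair {p₁ q₁ η₁ q₂ p₂ η₂ D : ℝ} (hY : ∀ n, Measurable (Y n))
    (hM : ∀ (n : ℕ) (w : ℕ → Fin 3) (j : Fin 3),
      μ.real {ω | (∀ k ≤ n, Y k ω = w k) ∧ Y (n + 1) ω = j}
        = ![![p₁, q₁, η₁], ![q₂, p₂, η₂], ![0, 0, 1]] (w n) j
          * μ.real {ω | ∀ k ≤ n, Y k ω = w k})
    (hq₁ : 0 ≤ q₁) (hη₁ : 0 ≤ η₁) (hq₂ : 0 ≤ q₂) (hη₂ : 0 ≤ η₂)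
    (h₁ : p₁ + q₁ + η₁ = 1) (h₂ : q₂ + p₂ + η₂ = 1)
    (hDdef : D = (q₁ + η₁) * (q₂ + η₂) - q₁ * q₂) (hD : 0 < D) (E : Set (Fin 3)) (m : ℕ) :
    HasSum (fun k => μ.real {ω | Y m ω ∈ E ∧ Y (m + k) ω = 0})
        ((μ.real {ω | Y m ω ∈ E ∧ Y m ω = 0} * (q₂ + η₂)
          + μ.real {ω | Y m ω ∈ E ∧ Y m ω = 1} * q₂) / D) ∧
      HasSum (fun k => μ.real {ω | Y m ω ∈ E ∧ Y (m + k) ω = 1})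
        ((μ.real {ω | Y m ω ∈ E ∧ Y m ω = 0} * q₁
          + μ.real {ω | Y m ω ∈ E ∧ Y m ω = 1} * (q₁ + η₁)) / D) := by
  refine hasSum_two_state (x := fun k => μ.real {ω | Y m ω ∈ E ∧ Y (m + k) ω = 0})
    (y := fun k => μ.real {ω | Y m ω ∈ E ∧ Y (m + k) ω = 1}) (fun _ => measureReal_nonneg) (fun _ => measureReal_nonneg)
    hq₁ hη₁ hq₂ hη₂ h₁ h₂ hDdef hD (fun k => ?_) (fun k => ?_)
  all_goals
    rw [measureReal_pair_succ (P := ![![p₁, q₁, η₁], ![q₂, p₂, η₂], ![0, 0, 1]]) hY hM,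
      Fin.sum_univ_three]
    simp

lemma tsum_measure_eq_of_hasSum {A : ℕ → Set Ω} {s : ℝ} (h : HasSum (fun n => μ.real (A n)) s) :
    ∑' n, μ (A n) = ENNReal.ofReal s := by
  rw [← h.tsum_eq, ENNReal.ofReal_tsum_of_nonneg (fun _ => measureReal_nonneg) h.summable]
  exact tsum_congr fun n => (ofReal_measureReal).symm

lemma integral_occTime (hY : ∀ n, Measurable (Y n)) {i : Fin 3} {s : ℝ}
    (h : HasSum (fun n => μ.real {ω | Y n ω = i}) s) : ∫ ω, (occTime Y i ω : ℝ) ∂μ = s := by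
  have hm : ∀ n, Measurable ({ω | Y n ω = i}.indicator (1 : Ω → ENNReal)) := fun n =>
    measurable_one.indicator (hY n (measurableSet_singleton i))
  have hl : ∫⁻ ω, ∑' n, {ω | Y n ω = i}.indicator (1 : Ω → ENNReal) ω ∂μ = ENNReal.ofReal s := by
    rw [lintegral_tsum fun n => (hm n).aemeasurable, ← tsum_measure_eq_of_hasSum h]
    exact tsum_congr fun n => lintegral_indicator_one (hY n (measurableSet_singleton i))
  have hM : Measurable fun ω => ∑' n, {ω | Y n ω = i}.indicator (1 : Ω → ENNReal) ω :=
    Measurable.tsum hm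
  simp_rw [occTime_eq_toReal_tsum]
  rw [integral_toReal hM.aemeasurable (ae_lt_top hM (by rw [hl]; exact ENNReal.ofReal_ne_top)), hl,
    ENNReal.toReal_ofReal (h.nonneg fun _ => measureReal_nonneg)]

lemma integral_occTime_mul_occTime (hY : ∀ n, Measurable (Y n)) {i j : Fin 3} (hij : i ≠ j)
    {c d s t : ℝ} (hc : 0 ≤ c) (hd : 0 ≤ d)
    (hi : HasSum (fun n => μ.real {ω | Y n ω = i}) s)
    (hj : HasSum (fun n => μ.real {ω | Y n ω = j}) t)
    (hc' : ∀ m, HasSum (fun k => μ.real {ω | Y m ω = i ∧ Y (m + k) ω = j})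
      (μ.real {ω | Y m ω = i} * c))
    (hd' : ∀ m, HasSum (fun k => μ.real {ω | Y m ω = j ∧ Y (m + k) ω = i})
      (μ.real {ω | Y m ω = j} * d)) :
    ∫ ω, (occTime Y i ω : ℝ) * (occTime Y j ω : ℝ) ∂μ = s * c + t * d := by
  have hm : ∀ a n, Measurable ({ω | Y n ω = a}.indicator (1 : Ω → ENNReal)) := fun a n =>
    measurable_one.indicator (hY n (measurableSet_singleton a))
  have hs : 0 ≤ s := hi.nonneg fun _ => measureReal_nonneg
  have ht : 0 ≤ t := hj.nonneg fun _ => measureReal_nonneg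
  have hmul : ∀ m n ω, {ω | Y m ω = i}.indicator (1 : Ω → ENNReal) ω
      * {ω | Y n ω = j}.indicator (1 : Ω → ENNReal) ω
        = {ω | Y m ω = i ∧ Y n ω = j}.indicator 1 ω := fun m n ω => by
    by_cases h₁ : Y m ω = i <;> by_cases h₂ : Y n ω = j <;> simp [Set.indicator, h₁, h₂]
  have weighted : ∀ {a : Fin 3} {u e : ℝ}, 0 ≤ e → HasSum (fun n => μ.real {ω | Y n ω = a}) u →
      ∑' n, ENNReal.ofReal (μ.real {ω | Y n ω = a} * e) = ENNReal.ofReal (u * e) := by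
    intro a u e he h
    have h' := h.mul_right e
    rw [← h'.tsum_eq, ENNReal.ofReal_tsum_of_nonneg
      (fun _ => mul_nonneg measureReal_nonneg he) h'.summable]
  have hl : ∫⁻ ω, (∑' n, {ω | Y n ω = i}.indicator (1 : Ω → ENNReal) ω)
      * (∑' n, {ω | Y n ω = j}.indicator (1 : Ω → ENNReal) ω) ∂μ
        = ENNReal.ofReal (s * c + t * d) := by
    have e₁ : ∀ ω, (∑' n, {ω | Y n ω = i}.indicator (1 : Ω → ENNReal) ω)
        * (∑' n, {ω | Y n ω = j}.indicator (1 : Ω → ENNReal) ω)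
          = ∑' m, ∑' n, {ω | Y m ω = i ∧ Y n ω = j}.indicator (1 : Ω → ENNReal) ω := fun ω => by
      simp_rw [← ENNReal.tsum_mul_right, ← ENNReal.tsum_mul_left, hmul]
    have hA : ∀ m n, MeasurableSet {ω | Y m ω = i ∧ Y n ω = j} := fun m n =>
      (hY m (measurableSet_singleton i)).inter (hY n (measurableSet_singleton j))
    have hAm : ∀ m n, Measurable ({ω | Y m ω = i ∧ Y n ω = j}.indicator (1 : Ω → ENNReal)) :=
      fun m n => measurable_one.indicator (hA m n)
    simp_rw [e₁]
    rw [lintegral_tsum fun m => (Measurable.tsum (hAm m)).aemeasurable]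
    simp_rw [lintegral_tsum fun n => (hAm _ n).aemeasurable, lintegral_indicator_one (hA _ _)]
    rw [ENNReal.tsum_tsum_eq_of_diag_eq_zero]
    · rw [ENNReal.ofReal_add (mul_nonneg hs hc) (mul_nonneg ht hd), ← weighted hc hi,
        ← weighted hd hj]
      congr 1
      · exact tsum_congr fun m => tsum_measure_eq_of_hasSum (hc' m)
      · refine tsum_congr fun m => ?_
        rw [← tsum_measure_eq_of_hasSum (hd' m)]
        simp_rw [and_comm]
    · intro n
      rw [show {ω | Y n ω = i ∧ Y n ω = j} = ∅ from
        Set.eq_empty_of_forall_notMem fun ω hω => hij (hω.1.symm.trans hω.2), measure_empty]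
  have hM : Measurable fun ω => (∑' n, {ω | Y n ω = i}.indicator (1 : Ω → ENNReal) ω)
      * (∑' n, {ω | Y n ω = j}.indicator (1 : Ω → ENNReal) ω) :=
    (Measurable.tsum (hm i)).mul (Measurable.tsum (hm j))
  simp_rw [occTime_eq_toReal_tsum, ← ENNReal.toReal_mul]
  rw [integral_toReal hM.aemeasurable (ae_lt_top hM (by rw [hl]; exact ENNReal.ofReal_ne_top)), hl,
    ENNReal.toReal_ofReal (by positivity)]

end Chain

/-- The bound for the explicit covariance `E₁ G₁₂ + E₂ G₂₁ - E₁ E₂`. -/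
lemma abs_cov_formula_le {δ q₁ η₁ q₂ η₂ a b D : ℝ} (hδ : 0 < δ)
    (hη₁ : 0 ≤ η₁) (hq₂ : 0 ≤ q₂) (h₁ : q₁ + η₁ ≤ 1) (h₂ : q₂ + η₂ ≤ 1)
    (ha : 0 ≤ a) (hb : 0 ≤ b) (hab : a + b ≤ 1) (hq₁ : δ < q₁) (hη₂ : δ < η₂)
    (hD : D = (q₁ + η₁) * (q₂ + η₂) - q₁ * q₂) :
    |(a * (q₂ + η₂) + b * q₂) / D * (q₁ / D) + (a * q₁ + b * (q₁ + η₁)) / D * (q₂ / D)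
        - (a * (q₂ + η₂) + b * q₂) / D * ((a * q₁ + b * (q₁ + η₁)) / D)|
      ≤ 1 / δ ^ 4 * (|q₁ / (q₁ + η₁) * (1 - a) - b| + q₂) := by
  have hDδ : δ ^ 2 ≤ D := by nlinarith [mul_nonneg hη₁ hq₂]
  have hDpos : 0 < D := lt_of_lt_of_le (by positivity) hDδ
  have hr : 0 < q₁ + η₁ := by linarith
  set r := q₁ / (q₁ + η₁) * (1 - a) - b with hrdef
  have hN₁ : 0 ≤ a * (q₂ + η₂) + b * q₂ := by
    have : 0 ≤ q₂ + η₂ := by linarith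
    positivity
  have hN₁' : a * (q₂ + η₂) + b * q₂ ≤ 1 := by nlinarith
  have hN₂ : 0 ≤ a * q₁ + b * (q₁ + η₁) := by
    have : 0 ≤ q₁ := by linarith
    positivity
  have hN₂' : a * q₁ + b * (q₁ + η₁) ≤ 1 := by nlinarith
  have heq : (a * (q₂ + η₂) + b * q₂) / D * (q₁ / D) + (a * q₁ + b * (q₁ + η₁)) / D * (q₂ / D)
        - (a * (q₂ + η₂) + b * q₂) / D * ((a * q₁ + b * (q₁ + η₁)) / D)
      = 1 / D ^ 2 * ((a * (q₂ + η₂) + b * q₂) * (q₁ + η₁) * r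
          + (a * q₁ + b * (q₁ + η₁)) * q₂) := by
    rw [hrdef]; field_simp; ring
  rw [heq, abs_mul, abs_of_pos (by positivity : 0 < 1 / D ^ 2)]
  have hD2 : 1 / D ^ 2 ≤ 1 / δ ^ 4 := by
    apply one_div_le_one_div_of_le (by positivity)
    calc δ ^ 4 = (δ ^ 2) ^ 2 := by ring
      _ ≤ D ^ 2 := by gcongr
  refine mul_le_mul hD2 ?_ (abs_nonneg _) (by positivity)
  refine (abs_add_le _ _).trans (add_le_add ?_ ?_)
  · rw [abs_mul, abs_of_nonneg (mul_nonneg hN₁ hr.le)]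
    exact mul_le_of_le_one_left (abs_nonneg _) (mul_le_one₀ hN₁' hr.le h₁)
  · rw [abs_of_nonneg (mul_nonneg hN₂ hq₂)]
    exact mul_le_of_le_one_left hq₂ hN₂'

/-- **Lemma (covariance of occupation times of a three-state absorbing Markov chain).**
States `0, 1, 2` of `Fin 3` play the roles of the states `1, 2, 3`; the transition matrix is
`(p₁ q₁ η₁ / q₂ p₂ η₂ / 0 0 1)` and the initial distribution is `(π₁, π₂, π₃)`. -/
theorem three_state_chain_covariance (δ : ℝ) (hδ : 0 < δ) :
    ∃ C : ℝ,
      ∀ (Ω : Type) (_ : MeasurableSpace Ω) (μ : Measure Ω), IsProbabilityMeasure μ →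
      ∀ (Y : ℕ → Ω → Fin 3) (p₁ q₁ η₁ q₂ p₂ η₂ π₁ π₂ π₃ : ℝ),
        (∀ n, Measurable (Y n)) →
        0 ≤ p₁ → 0 ≤ q₁ → 0 ≤ η₁ → 0 ≤ q₂ → 0 ≤ p₂ → 0 ≤ η₂ →
        p₁ + q₁ + η₁ = 1 → q₂ + p₂ + η₂ = 1 →
        0 ≤ π₁ → 0 ≤ π₂ → 0 ≤ π₃ → π₁ + π₂ + π₃ = 1 →
        -- initial distribution
        (μ {ω | Y 0 ω = 0}).toReal = π₁ →
        (μ {ω | Y 0 ω = 1}).toReal = π₂ →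
        (μ {ω | Y 0 ω = 2}).toReal = π₃ →
        -- Markov property with the prescribed transition matrix
        (∀ (n : ℕ) (w : ℕ → Fin 3) (j : Fin 3),
          (μ {ω | (∀ k ≤ n, Y k ω = w k) ∧ Y (n + 1) ω = j}).toReal
            = (![![p₁, q₁, η₁], ![q₂, p₂, η₂], ![0, 0, 1]] (w n) j)
              * (μ {ω | ∀ k ≤ n, Y k ω = w k}).toReal) →
        -- the assumption (Ell)
        δ < q₁ → δ < η₂ →
        |(∫ ω, (occTime Y 0 ω : ℝ) * (occTime Y 1 ω : ℝ) ∂μ)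
            - (∫ ω, (occTime Y 0 ω : ℝ) ∂μ) * (∫ ω, (occTime Y 1 ω : ℝ) ∂μ)|
          ≤ C * (|q₁ / (q₁ + η₁) * (1 - π₁) - π₂| + q₂) := by
  refine ⟨1 / δ ^ 4, ?_⟩
  intro Ω _ μ _ Y p₁ q₁ η₁ q₂ p₂ η₂ π₁ π₂ π₃ hY hp₁ hq₁ hη₁ hq₂ hp₂ hη₂ h₁ h₂ hπ₁ hπ₂ hπ₃ hπ
    hi₁ hi₂ _ hM hδ₁ hδ₂
  obtain ⟨D, hD⟩ : ∃ D, D = (q₁ + η₁) * (q₂ + η₂) - q₁ * q₂ := ⟨_, rfl⟩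
  have hDpos : 0 < D := by
    have : 0 < q₁ * η₂ := mul_pos (hδ.trans hδ₁) (hδ.trans hδ₂)
    nlinarith [mul_nonneg hη₁ hq₂, mul_nonneg hη₁ hη₂]
  have pair := hasSum_measureReal_pair (μ := μ) hY hM hq₁ hη₁ hq₂ hη₂ h₁ h₂ hD hDpos
  have start := pair Set.univ 0
  simp only [Set.mem_univ, true_and, zero_add] at start
  rw [show μ.real {ω | Y 0 ω = 0} = π₁ from hi₁, show μ.real {ω | Y 0 ω = 1} = π₂ from hi₂] at start
  have h₀₁ : ∀ m, HasSum (fun k => μ.real {ω | Y m ω = 0 ∧ Y (m + k) ω = 1})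
      (μ.real {ω | Y m ω = 0} * (q₁ / D)) := fun m => by
    have h := (pair {0} m).2
    have e : ∀ ω, ¬ (Y m ω = 0 ∧ Y m ω = 1) := fun ω h => by simp [h.1] at h
    simpa [e, mul_div_assoc] using h
  have h₁₀ : ∀ m, HasSum (fun k => μ.real {ω | Y m ω = 1 ∧ Y (m + k) ω = 0})
      (μ.real {ω | Y m ω = 1} * (q₂ / D)) := fun m => by
    have h := (pair {1} m).1
    have e : ∀ ω, ¬ (Y m ω = 1 ∧ Y m ω = 0) := fun ω h => by simp [h.1] at h
    simpa [e, mul_div_assoc] using h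
  rw [integral_occTime_mul_occTime hY (by decide) (by positivity) (by positivity)
    start.1 start.2 h₀₁ h₁₀, integral_occTime hY start.1, integral_occTime hY start.2]
  exact abs_cov_formula_le hδ hη₁ hq₂ (by linarith) (by linarith) hπ₁ hπ₂ (by linarith)
    hδ₁ hδ₂ hD
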